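/- There exists a universal constant c > 0 with the following property. Let n ≥ 2, d ≥ 1 be integers, let M ≥ 2 and κ ≥ 2 be reals, and let A = a₁ ∘ ⋯ ∘ a_n ∈ ℝ^{n×d} be a matrix whose entries are integers of absolute value at most M, such that for every i ∈ [n] the prefix matrix Aᵢ = a₁ ∘ ⋯ ∘ aᵢ has condition number at most κ. Let ℓᵢ = sup over x ∈ ℝ^d with Aᵢx ≠ 0 of |⟨aᵢ, x⟩| / ‖Aᵢx‖₁ be the online L₁ sensitivity of row aᵢ. Then Σᵢ₌₁ⁿ ℓᵢ ≤ c · d · log(nM) · log κ. -/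

import Mathlib

/-- The `L₂` norm of the `i`-th prefix matrix `Aᵢ = a₁ ∘ ⋯ ∘ aᵢ` applied to `x`,
i.e. `‖Aᵢ x‖₂`. -/
noncomputable def prefixL2 (n d : ℕ) (A : Fin n → Fin d → ℝ) (i : Fin n)
    (x : Fin d → ℝ) : ℝ :=
  Real.sqrt (∑ j ∈ Finset.Iic i, (∑ t, A j t * x t) ^ 2)

/-- `x` is orthogonal to the kernel of the prefix matrix `Aᵢ`. -/
def prefixKerOrth (n d : ℕ) (A : Fin n → Fin d → ℝ) (i : Fin n)
    (x : Fin d → ℝ) : Prop :=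
  ∀ z : Fin d → ℝ, (∀ j ∈ Finset.Iic i, ∑ t, A j t * z t = 0) → ∑ t, x t * z t = 0

/-- The prefix matrix `Aᵢ` has condition number (ratio of its largest singular value
to its smallest nonzero singular value) at most `κ`: for all unit vectors `x, y`
orthogonal to its kernel, `‖Aᵢ x‖₂ ≤ κ · ‖Aᵢ y‖₂`. -/
def prefixCondLe (n d : ℕ) (A : Fin n → Fin d → ℝ) (i : Fin n) (κ : ℝ) : Prop :=
  ∀ x y : Fin d → ℝ, (∑ t, (x t) ^ 2) = 1 → (∑ t, (y t) ^ 2) = 1 →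
    prefixKerOrth n d A i x → prefixKerOrth n d A i y →
    prefixL2 n d A i x ≤ κ * prefixL2 n d A i y

/-- The online `L₁` sensitivity of row `aᵢ`:
`sup { |⟨aᵢ, x⟩| / ‖Aᵢ x‖₁ : x ∈ ℝ^d, Aᵢ x ≠ 0 }` (equal to `0` when the set is
empty). -/
noncomputable def onlineL1Sens (n d : ℕ) (A : Fin n → Fin d → ℝ) (i : Fin n) : ℝ :=
  sSup { r : ℝ | ∃ x : Fin d → ℝ,
    (∑ j ∈ Finset.Iic i, |∑ t, A j t * x t|) ≠ 0 ∧
    r = |∑ t, A i t * x t| / ∑ j ∈ Finset.Iic i, |∑ t, A j t * x t| }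

open Matrix in
/-- The matrix determinant lemma for a symmetric rank-one update. -/
lemma det_add_smul_vecMulVec_self {m : Type*} [Fintype m] [DecidableEq m]
    {P : Matrix m m ℝ} (hP : IsUnit P.det) (c : ℝ) (a : m → ℝ) :
    (P + c • vecMulVec a a).det = P.det * (1 + c * (a ⬝ᵥ P⁻¹ *ᵥ a)) := by
  have h : c • vecMulVec a a = replicateCol Unit (c • a) * replicateRow Unit a := by
    ext s t
    simp [vecMulVec_apply, Matrix.mul_apply, mul_assoc]
  rw [h, det_add_replicateCol_mul_replicateRow hP,
    det_unique (1 + replicateRow Unit a * P⁻¹ * replicateCol Unit (c • a)), Matrix.mul_assoc]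
  congr 2
  rw [← replicateCol_mulVec, mulVec_smul, Matrix.add_apply, Matrix.one_apply_eq,
    replicateRow_mul_replicateCol_apply, dotProduct_smul, smul_eq_mul]

open Matrix in
/-- Cauchy–Schwarz for the dual pair of norms given by a positive definite matrix. -/
lemma Matrix.PosDef.sq_dotProduct_le {m : Type*} [Fintype m] [DecidableEq m]
    {P : Matrix m m ℝ} (hP : P.PosDef) (a x : m → ℝ) :
    (a ⬝ᵥ x) ^ 2 ≤ (a ⬝ᵥ P⁻¹ *ᵥ a) * (x ⬝ᵥ P *ᵥ x) := by
  set y := P⁻¹ *ᵥ a with hy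
  have hPy : P *ᵥ y = a := by
    rw [hy, mulVec_mulVec, mul_nonsing_inv _ hP.det_pos.ne'.isUnit, one_mulVec]
  have hsymm : y ⬝ᵥ P *ᵥ x = a ⬝ᵥ x := by
    have hT : Pᵀ = P := by simpa using hP.isHermitian.eq
    rw [dotProduct_mulVec, ← mulVec_transpose, hT, hPy]
  have h : ∀ r : ℝ, 0 ≤ (a ⬝ᵥ y) * (r * r) + (2 * (a ⬝ᵥ x)) * r + x ⬝ᵥ P *ᵥ x := fun r ↦ by
    have h0 := hP.posSemidef.dotProduct_mulVec_nonneg (x + r • y)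
    simp only [star_trivial, mulVec_add, mulVec_smul, hPy, add_dotProduct, dotProduct_add,
      smul_dotProduct, dotProduct_smul, hsymm, smul_eq_mul, dotProduct_comm x a,
      dotProduct_comm y a] at h0
    linarith
  have hd := discrim_le_zero h
  rw [discrim] at hd
  nlinarith

open Matrix in
/-- The arithmetic–geometric mean inequality for the eigenvalues, in logarithmic form. -/
lemma Matrix.PosDef.log_det_le {m : Type*} [Fintype m] [DecidableEq m]
    {P : Matrix m m ℝ} (hP : P.PosDef) {b : ℝ} (hb : 0 < b)
    (htr : P.trace ≤ Fintype.card m * b) :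
    Real.log P.det ≤ Fintype.card m * Real.log b := by
  have hpos := hP.eigenvalues_pos
  have hdet : P.det = ∏ k, hP.1.eigenvalues k := by simpa using hP.1.det_eq_prod_eigenvalues
  have htrace : P.trace = ∑ k, hP.1.eigenvalues k := by simpa using hP.1.trace_eq_sum_eigenvalues
  rw [hdet, Real.log_prod fun k _ ↦ (hpos k).ne']
  have h : ∀ k, Real.log (hP.1.eigenvalues k) ≤ Real.log b + (hP.1.eigenvalues k / b - 1) := by
    intro k
    have := Real.log_le_sub_one_of_pos (div_pos (hpos k) hb)
    rw [Real.log_div (hpos k).ne' hb.ne'] at this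
    linarith
  refine (Finset.sum_le_sum fun k _ ↦ h k).trans ?_
  have h1 : P.trace / b ≤ Fintype.card m := by rwa [div_le_iff₀ hb]
  simp only [Finset.sum_add_distrib, Finset.sum_sub_distrib, ← Finset.sum_div, ← htrace,
    Finset.sum_const, Finset.card_univ, nsmul_eq_mul]
  linarith

/-- The regularized Gram matrix of the rows indexed by `S`, the `j`-th row being weighted
by `(w j)⁻¹`. -/
noncomputable def regGram {ι m : Type*} [DecidableEq m] (A : ι → m → ℝ) (w : ι → ℝ) (l : ℝ)
    (S : Finset ι) : Matrix m m ℝ :=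
  l • (1 : Matrix m m ℝ) + ∑ j ∈ S, (w j)⁻¹ • Matrix.vecMulVec (A j) (A j)

section regGram

open Matrix

variable {ι m : Type*} [Fintype m] [DecidableEq m] (A : ι → m → ℝ) (w : ι → ℝ) (l : ℝ)

lemma dotProduct_regGram_mulVec (S : Finset ι) (x : m → ℝ) :
    x ⬝ᵥ regGram A w l S *ᵥ x = l * (x ⬝ᵥ x) + ∑ j ∈ S, (w j)⁻¹ * (A j ⬝ᵥ x) ^ 2 := by
  simp only [regGram, add_mulVec, dotProduct_add, smul_mulVec, one_mulVec, dotProduct_smul,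
    smul_eq_mul, sum_mulVec, dotProduct_sum]
  congr 1
  refine Finset.sum_congr rfl fun j _ ↦ ?_
  rw [vecMulVec_mulVec, op_smul_eq_smul, dotProduct_smul, dotProduct_comm x (A j), smul_eq_mul]
  ring

variable {A w l}

lemma posDef_regGram (hw : ∀ j, 0 ≤ w j) (hl : 0 < l) (S : Finset ι) :
    (regGram A w l S).PosDef := by
  refine .of_dotProduct_mulVec_pos ?_ fun x hx ↦ ?_
  · ext s t
    simp [regGram, conjTranspose_apply, Matrix.sum_apply, Matrix.one_apply, vecMulVec_apply,
      mul_comm, eq_comm]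
  · rw [star_trivial, dotProduct_regGram_mulVec]
    have h1 : 0 < x ⬝ᵥ x := by simpa using dotProduct_star_self_pos_iff.mpr hx
    have h2 : 0 ≤ ∑ j ∈ S, (w j)⁻¹ * (A j ⬝ᵥ x) ^ 2 :=
      Finset.sum_nonneg fun j _ ↦ mul_nonneg (inv_nonneg.mpr (hw j)) (sq_nonneg _)
    positivity

lemma log_det_regGram_empty :
    Real.log (regGram A w l ∅).det = Fintype.card m * Real.log l := by
  simp [regGram]

lemma trace_regGram (S : Finset ι) :
    (regGram A w l S).trace = ∑ t, (l + ∑ j ∈ S, (w j)⁻¹ * (A j t) ^ 2) := by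
  simp [regGram, Matrix.trace, Matrix.sum_apply, vecMulVec_apply, sq]

lemma weight_le_log_det_regGram_insert [DecidableEq ι] (hw : ∀ j, 0 ≤ w j) (hl : 0 < l)
    {S : Finset ι} {i : ι} (hi : i ∉ S) (hi1 : w i ≤ 1)
    (h : w i ^ 2 ≤ 2 * (A i ⬝ᵥ (regGram A w l S)⁻¹ *ᵥ A i)) :
    w i / 3 ≤ Real.log (regGram A w l (insert i S)).det
      - Real.log (regGram A w l S).det := by
  have hS := (posDef_regGram (A := A) hw hl S).det_pos
  have hins : regGram A w l (insert i S)
      = regGram A w l S + (w i)⁻¹ • vecMulVec (A i) (A i) := by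
    rw [regGram, Finset.sum_insert hi, regGram]
    abel
  rw [hins, det_add_smul_vecMulVec_self hS.ne'.isUnit]
  set τ := A i ⬝ᵥ (regGram A w l S)⁻¹ *ᵥ A i
  rcases (hw i).eq_or_lt with h0 | h0
  · simp [← h0]
  have hτ : w i / 2 ≤ (w i)⁻¹ * τ := by
    rw [inv_mul_eq_div, le_div_iff₀ h0]
    nlinarith
  have hpos : 0 < 1 + w i / 2 := by positivity
  rw [Real.log_mul hS.ne' (by linarith), add_sub_cancel_left]
  calc w i / 3 ≤ 1 - (1 + w i / 2)⁻¹ := by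
        rw [← sub_nonneg]
        have : 1 - (1 + w i / 2)⁻¹ - w i / 3 = w i * (1 - w i) / (6 * (1 + w i / 2)) := by
          field_simp
          ring
        rw [this]
        have := sub_nonneg.mpr hi1
        positivity
    _ ≤ Real.log (1 + w i / 2) := Real.one_sub_inv_le_log_of_pos hpos
    _ ≤ Real.log (1 + (w i)⁻¹ * τ) := Real.log_le_log hpos (by linarith)

end regGram

lemma Fin.sum_le_of_forall_le_insert_Iio {n : ℕ} (g : Fin n → ℝ) (f : Finset (Fin n) → ℝ)
    (h : ∀ i, g i ≤ f (insert i (Finset.Iio i)) - f (Finset.Iio i)) :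
    ∑ i, g i ≤ f Finset.univ - f ∅ := by
  have key : ∀ k ≤ n, ∑ i with i.val < k, g i
      ≤ f (Finset.univ.filter fun i : Fin n ↦ i.val < k) - f ∅ := by
    intro k
    induction k with
    | zero => simp
    | succ k ih =>
      intro hk
      have h1 : (Finset.univ.filter fun i : Fin n ↦ i.val < k) = Finset.Iio ⟨k, hk⟩ := by
        ext i; simp [Fin.lt_def]
      have h2 : (Finset.univ.filter fun i : Fin n ↦ i.val < k + 1)
          = insert ⟨k, hk⟩ (Finset.Iio ⟨k, hk⟩) := by
        ext i
        simp only [Finset.mem_filter, Finset.mem_univ, true_and, Finset.mem_insert, Fin.ext_iff,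
          Finset.mem_Iio, Fin.lt_def]
        omega
      have := ih (by omega)
      have := h ⟨k, hk⟩
      rw [h1] at *
      rw [h2, Finset.sum_insert (by simp)]
      linarith
  simpa using key n le_rfl

section onlineL1Sens

variable {n d : ℕ} {A : Fin n → Fin d → ℝ} {i : Fin n}

lemma abs_row_le_prefixL1 {j : Fin n} (hj : j ≤ i) (x : Fin d → ℝ) :
    |∑ t, A j t * x t| ≤ ∑ k ∈ Finset.Iic i, |∑ t, A k t * x t| :=
  Finset.single_le_sum (f := fun k ↦ |∑ t, A k t * x t|) (fun _ _ ↦ abs_nonneg _)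
    (Finset.mem_Iic.mpr hj)

lemma onlineL1Sens_nonneg : 0 ≤ onlineL1Sens n d A i := by
  refine Real.sSup_nonneg ?_
  rintro r ⟨x, -, rfl⟩
  positivity

lemma onlineL1Sens_le {b : ℝ} (hb : 0 ≤ b)
    (h : ∀ x : Fin d → ℝ, |∑ t, A i t * x t| ≤ b * ∑ j ∈ Finset.Iic i, |∑ t, A j t * x t|) :
    onlineL1Sens n d A i ≤ b := by
  refine Real.sSup_le ?_ hb
  rintro r ⟨x, -, rfl⟩
  exact div_le_of_le_mul₀ (Finset.sum_nonneg fun _ _ ↦ abs_nonneg _) hb (h x)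

lemma onlineL1Sens_le_one : onlineL1Sens n d A i ≤ 1 :=
  onlineL1Sens_le zero_le_one fun x ↦ by simpa using abs_row_le_prefixL1 le_rfl x

lemma abs_row_le_onlineL1Sens_mul (x : Fin d → ℝ) :
    |∑ t, A i t * x t|
      ≤ onlineL1Sens n d A i * ∑ j ∈ Finset.Iic i, |∑ t, A j t * x t| := by
  have hle := abs_row_le_prefixL1 (A := A) (le_refl i) x
  have hnonneg := (abs_nonneg _).trans hle
  rcases hnonneg.eq_or_lt with h0 | h0
  · rw [← h0] at hle ⊢
    simpa using hle
  · rw [← div_le_iff₀ h0]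
    refine le_csSup ⟨1, ?_⟩ ⟨x, h0.ne', rfl⟩
    rintro r ⟨y, -, rfl⟩
    exact div_le_one_of_le₀ (abs_row_le_prefixL1 le_rfl y)
      (Finset.sum_nonneg fun _ _ ↦ abs_nonneg _)

lemma sum_inv_onlineL1Sens_mul_sq_le {S : Finset (Fin n)} (hS : S ⊆ Finset.Iic i)
    (x : Fin d → ℝ) :
    ∑ j ∈ S, (onlineL1Sens n d A j)⁻¹ * (∑ t, A j t * x t) ^ 2
      ≤ (∑ j ∈ Finset.Iic i, |∑ t, A j t * x t|) ^ 2 := by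
  set s := ∑ j ∈ Finset.Iic i, |∑ t, A j t * x t| with hs
  have hs0 : 0 ≤ s := Finset.sum_nonneg fun _ _ ↦ abs_nonneg _
  have hterm : ∀ j ∈ S, (onlineL1Sens n d A j)⁻¹ * (∑ t, A j t * x t) ^ 2
      ≤ |∑ t, A j t * x t| * s := by
    intro j hj
    rcases (onlineL1Sens_nonneg (A := A) (i := j)).eq_or_lt with h0 | h0
    · rw [← h0]
      simpa using mul_nonneg (abs_nonneg _) hs0
    · rw [inv_mul_le_iff₀ h0, ← sq_abs, sq]
      have hpre : ∑ k ∈ Finset.Iic j, |∑ t, A k t * x t| ≤ s :=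
        Finset.sum_le_sum_of_subset_of_nonneg
          (Finset.Iic_subset_Iic.mpr (Finset.mem_Iic.mp (hS hj))) fun _ _ _ ↦ abs_nonneg _
      have := (abs_row_le_onlineL1Sens_mul (A := A) (i := j) x).trans
        (mul_le_mul_of_nonneg_left hpre h0.le)
      nlinarith [abs_nonneg (∑ t, A j t * x t)]
  calc _ ≤ ∑ j ∈ S, |∑ t, A j t * x t| * s := Finset.sum_le_sum hterm
    _ ≤ ∑ j ∈ Finset.Iic i, |∑ t, A j t * x t| * s :=
        Finset.sum_le_sum_of_subset_of_nonneg hS fun _ _ _ ↦ mul_nonneg (abs_nonneg _) hs0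
    _ = s ^ 2 := by rw [← Finset.sum_mul, ← hs, sq]

/-- Every vector may be replaced by its component orthogonal to the kernel of the prefix. -/
lemma exists_prefixKerOrth_eq (x : Fin d → ℝ) :
    ∃ y : Fin d → ℝ, prefixKerOrth n d A i y ∧
      ∀ j ∈ Finset.Iic i, ∑ t, A j t * y t = ∑ t, A j t * x t := by
  let K : Submodule ℝ (EuclideanSpace ℝ (Fin d)) :=
    { carrier := {z | ∀ j ∈ Finset.Iic i, ∑ t, A j t * z t = 0}
      zero_mem' := by simp
      add_mem' := fun {u v} hu hv j hj ↦ by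
        simp only [PiLp.add_apply, mul_add, Finset.sum_add_distrib, hu j hj, hv j hj, add_zero]
      smul_mem' := fun c u hu j hj ↦ by
        simp only [PiLp.smul_apply, smul_eq_mul, mul_left_comm _ c, ← Finset.mul_sum, hu j hj,
          mul_zero] }
  obtain ⟨z, hz, y, hy, hxy⟩ := K.exists_add_mem_mem_orthogonal (WithLp.toLp 2 x)
  have hx : ∀ t, x t = z t + y t := fun t ↦ congrArg (fun v : EuclideanSpace ℝ (Fin d) ↦ v t) hxy
  refine ⟨fun t ↦ y t, fun u hu ↦ ?_, fun j hj ↦ ?_⟩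
  · have := (K.mem_orthogonal y).mp hy (WithLp.toLp 2 u) hu
    simpa [PiLp.inner_apply] using this
  · simp only [hx, mul_add, Finset.sum_add_distrib, hz j hj, zero_add]

lemma prefixKerOrth.const_mul {x : Fin d → ℝ} (hx : prefixKerOrth n d A i x) (c : ℝ) :
    prefixKerOrth n d A i (fun t ↦ c * x t) := fun z hz ↦ by
  simp only [mul_assoc, ← Finset.mul_sum, hx z hz, mul_zero]

lemma prefixL2_const_mul (c : ℝ) (x : Fin d → ℝ) :
    prefixL2 n d A i (fun t ↦ c * x t) = |c| * prefixL2 n d A i x := by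
  simp only [prefixL2, mul_left_comm _ c, ← Finset.mul_sum, mul_pow]
  rw [Real.sqrt_mul (sq_nonneg c), Real.sqrt_sq_eq_abs]

lemma prefixL2_le_prefixL1 (x : Fin d → ℝ) :
    prefixL2 n d A i x ≤ ∑ j ∈ Finset.Iic i, |∑ t, A j t * x t| := by
  refine Real.sqrt_le_iff.mpr ⟨Finset.sum_nonneg fun _ _ ↦ abs_nonneg _, ?_⟩
  simpa using Finset.sum_sq_le_sq_sum_of_nonneg (s := Finset.Iic i)
    (f := fun j ↦ |∑ t, A j t * x t|) fun _ _ ↦ abs_nonneg _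

/-- If a row of the prefix has Euclidean norm at least one, so has its largest singular value,
and hence the smallest nonzero one is at least `κ⁻¹`. -/
lemma sqrt_sum_sq_le_mul_prefixL2 {κ : ℝ} (hcond : prefixCondLe n d A i κ)
    (hrow : 1 ≤ ∑ t, A i t ^ 2) {x : Fin d → ℝ} (hx : prefixKerOrth n d A i x) :
    Real.sqrt (∑ t, x t ^ 2) ≤ κ * prefixL2 n d A i x := by
  have hnormalize : ∀ v : Fin d → ℝ, 0 < ∑ t, v t ^ 2 →
      ∑ t, ((Real.sqrt (∑ t, v t ^ 2))⁻¹ * v t) ^ 2 = 1 := fun v hv ↦ by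
    simp only [mul_pow, ← Finset.mul_sum, inv_pow, Real.sq_sqrt hv.le]
    exact inv_mul_cancel₀ hv.ne'
  rcases (Finset.sum_nonneg fun t _ ↦ sq_nonneg (x t) : 0 ≤ ∑ t, x t ^ 2).eq_or_lt with h0 | h0
  · have hx0 : ∀ t, x t = 0 := fun t ↦ by
      simpa using (Finset.sum_eq_zero_iff_of_nonneg fun t _ ↦ sq_nonneg (x t)).mp h0.symm t
    simp [prefixL2, hx0]
  have hi : prefixKerOrth n d A i (A i) := fun z hz ↦ hz i (by simp)
  have hmain := hcond _ _ (hnormalize (A i) (by linarith)) (hnormalize x h0)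
    (hi.const_mul _) (hx.const_mul _)
  rw [prefixL2_const_mul, prefixL2_const_mul, abs_of_nonneg (by positivity),
    abs_of_nonneg (by positivity)] at hmain
  set r := Real.sqrt (∑ t, A i t ^ 2)
  have hr : 1 ≤ r := Real.one_le_sqrt.mpr hrow
  have hrr : r ^ 2 ≤ prefixL2 n d A i (A i) := by
    rw [Real.sq_sqrt (by linarith)]
    refine Real.le_sqrt_of_sq_le ?_
    have := Finset.single_le_sum (f := fun j ↦ (∑ t, A j t * A i t) ^ 2) (s := Finset.Iic i)
      (fun _ _ ↦ sq_nonneg _) (Finset.mem_Iic.mpr (le_refl i))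
    simpa [sq] using this
  have hone : 1 ≤ r⁻¹ * prefixL2 n d A i (A i) := by
    rw [inv_mul_eq_div, le_div_iff₀ (by linarith)]
    nlinarith
  have hs : 0 < Real.sqrt (∑ t, x t ^ 2) := Real.sqrt_pos.mpr h0
  have h1 := hone.trans hmain
  rw [mul_left_comm, inv_mul_eq_div, le_div_iff₀ hs, one_mul] at h1
  exact h1

open Matrix in
/-- The online sensitivity is controlled by the leverage score of the row with respect to the
preceding rows, reweighted by their own sensitivities. -/
lemma sq_onlineL1Sens_le {κ : ℝ} (hκ : 0 < κ) (hcond : prefixCondLe n d A i κ)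
    (hrow : 1 ≤ ∑ t, A i t ^ 2) :
    onlineL1Sens n d A i ^ 2 ≤ 2 * (A i ⬝ᵥ
      (regGram A (onlineL1Sens n d A) (κ ^ 2)⁻¹ (Finset.Iio i))⁻¹ *ᵥ A i) := by
  have hP := posDef_regGram (A := A) (w := onlineL1Sens n d A) (l := (κ ^ 2)⁻¹)
    (fun j ↦ onlineL1Sens_nonneg) (by positivity) (Finset.Iio i)
  set τ := A i ⬝ᵥ (regGram A (onlineL1Sens n d A) (κ ^ 2)⁻¹ (Finset.Iio i))⁻¹ *ᵥ A i
  have hτ : 0 ≤ τ := by simpa using hP.inv.posSemidef.dotProduct_mulVec_nonneg (A i)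
  refine (Real.le_sqrt onlineL1Sens_nonneg (by positivity)).mp ?_
  refine onlineL1Sens_le (Real.sqrt_nonneg _) fun x ↦ ?_
  obtain ⟨y, hy, hyx⟩ := exists_prefixKerOrth_eq (A := A) (i := i) x
  have hsum : ∑ j ∈ Finset.Iic i, |∑ t, A j t * x t| = ∑ j ∈ Finset.Iic i, |∑ t, A j t * y t| :=
    Finset.sum_congr rfl fun j hj ↦ by rw [hyx j hj]
  rw [← hyx i (by simp), hsum]
  set s := ∑ j ∈ Finset.Iic i, |∑ t, A j t * y t|
  have hs : 0 ≤ s := Finset.sum_nonneg fun _ _ ↦ abs_nonneg _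
  have hreg : (κ ^ 2)⁻¹ * (y ⬝ᵥ y) ≤ s ^ 2 := by
    have h1 := (sqrt_sum_sq_le_mul_prefixL2 hcond hrow hy).trans
      (mul_le_mul_of_nonneg_left (prefixL2_le_prefixL1 y) hκ.le)
    have h2 := (Real.sqrt_le_iff.mp h1).2
    rw [inv_mul_le_iff₀ (by positivity), ← mul_pow]
    simpa [dotProduct, sq] using h2
  have hquad : y ⬝ᵥ regGram A (onlineL1Sens n d A) (κ ^ 2)⁻¹ (Finset.Iio i) *ᵥ y
      ≤ 2 * s ^ 2 := by
    rw [dotProduct_regGram_mulVec]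
    have := sum_inv_onlineL1Sens_mul_sq_le (A := A) (Finset.Iio_subset_Iic_self (a := i)) y
    simp only [dotProduct] at hreg ⊢
    linarith
  refine abs_le_of_sq_le_sq ?_ (by positivity)
  rw [mul_pow, Real.sq_sqrt (by positivity)]
  calc (∑ t, A i t * y t) ^ 2 ≤ τ * _ := hP.sq_dotProduct_le (A i) y
    _ ≤ τ * (2 * s ^ 2) := mul_le_mul_of_nonneg_left hquad hτ
    _ = 2 * τ * s ^ 2 := by ring

lemma onlineL1Sens_eq_zero (h : A i = 0) : onlineL1Sens n d A i = 0 :=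
  le_antisymm (onlineL1Sens_le le_rfl fun x ↦ by simp [h]) onlineL1Sens_nonneg

lemma one_le_sum_sq_of_int {m : Type*} [Fintype m] {a : m → ℝ}
    (hint : ∀ t, ∃ z : ℤ, a t = z) (ha : a ≠ 0) : 1 ≤ ∑ t, a t ^ 2 := by
  obtain ⟨t, ht⟩ := Function.ne_iff.mp ha
  obtain ⟨z, hz⟩ := hint t
  have hz0 : z ≠ 0 := by
    rintro rfl
    simp [hz] at ht
  have hz1 : (1 : ℝ) ≤ a t ^ 2 := by
    rw [hz]
    exact_mod_cast (one_le_sq_iff_one_le_abs z).mpr (Int.one_le_abs hz0)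
  exact hz1.trans (Finset.single_le_sum (f := fun t ↦ a t ^ 2) (fun _ _ ↦ sq_nonneg _)
    (Finset.mem_univ t))

open Matrix in
/-- The total online sensitivity is controlled by the growth of the log-determinant. -/
lemma sum_onlineL1Sens_div_three_le {κ : ℝ} (hκ : 0 < κ)
    (hint : ∀ i t, ∃ z : ℤ, A i t = z) (hcond : ∀ i, prefixCondLe n d A i κ) :
    ∑ i, onlineL1Sens n d A i / 3
      ≤ Real.log (regGram A (onlineL1Sens n d A) (κ ^ 2)⁻¹ Finset.univ).det
        - d * Real.log (κ ^ 2)⁻¹ := by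
  have hl : 0 < (κ ^ 2)⁻¹ := by positivity
  have hstep (i : Fin n) : onlineL1Sens n d A i / 3
      ≤ Real.log (regGram A (onlineL1Sens n d A) (κ ^ 2)⁻¹ (insert i (Finset.Iio i))).det
        - Real.log (regGram A (onlineL1Sens n d A) (κ ^ 2)⁻¹ (Finset.Iio i)).det := by
    have hsq : onlineL1Sens n d A i ^ 2 ≤ 2 * (A i ⬝ᵥ
        (regGram A (onlineL1Sens n d A) (κ ^ 2)⁻¹ (Finset.Iio i))⁻¹ *ᵥ A i) := by
      by_cases h0 : A i = 0
      · rw [onlineL1Sens_eq_zero h0, h0, zero_dotProduct]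
        norm_num
      · exact sq_onlineL1Sens_le hκ (hcond i) (one_le_sum_sq_of_int (hint i) h0)
    exact weight_le_log_det_regGram_insert (A := A) (w := onlineL1Sens n d A)
      (S := Finset.Iio i) (i := i) (fun _ ↦ onlineL1Sens_nonneg) hl
      Finset.notMem_Iio_self onlineL1Sens_le_one hsq
  have h := Fin.sum_le_of_forall_le_insert_Iio (fun i ↦ onlineL1Sens n d A i / 3)
    (fun S ↦ Real.log (regGram A (onlineL1Sens n d A) (κ ^ 2)⁻¹ S).det) hstep
  rwa [log_det_regGram_empty, Fintype.card_fin] at h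

lemma trace_regGram_onlineL1Sens_le {M l : ℝ} (hn : 0 < n) (hA : ∀ i t, |A i t| ≤ M) :
    (regGram A (onlineL1Sens n d A) l Finset.univ).trace ≤ d * (l + (n * M) ^ 2) := by
  rw [trace_regGram]
  refine (Finset.sum_le_card_nsmul _ _ (l + (n * M) ^ 2) fun t _ ↦ ?_).trans_eq (by simp [mul_add])
  let i : Fin n := ⟨n - 1, by omega⟩
  have hi : Finset.Iic i = Finset.univ := by
    ext j
    simp only [Finset.mem_Iic, Finset.mem_univ, iff_true, Fin.le_def, i]
    omega
  have h := sum_inv_onlineL1Sens_mul_sq_le (A := A) (i := i) (S := Finset.univ)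
    (by rw [hi]) (Pi.single t 1)
  simp only [hi, Pi.single_apply, mul_ite, mul_one, mul_zero, Finset.sum_ite_eq',
    Finset.mem_univ, if_true] at h
  have h2 : ∑ j, |A j t| ≤ n * M := by
    simpa using Finset.sum_le_card_nsmul Finset.univ (fun j ↦ |A j t|) M fun j _ ↦ hA j t
  have h3 := pow_le_pow_left₀ (Finset.sum_nonneg fun j _ ↦ abs_nonneg (A j t)) h2 2
  linarith

end onlineL1Sens

/-- Total online `L₁` sensitivity bound: there is a universal constant `c > 0` such
that for any `n ≥ 2`, `d ≥ 1`, `M, κ ≥ 2`, and any matrix `A ∈ ℝ^{n×d}` with integer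
entries of magnitude at most `M` all of whose prefixes have condition number at most
`κ`, the online `L₁` sensitivities sum to at most `c · d · log (n M) · log κ`. -/
theorem sum_online_l1_sensitivities :
    ∃ c : ℝ, 0 < c ∧
      ∀ (n d : ℕ), 2 ≤ n → 1 ≤ d →
      ∀ (M κ : ℝ), 2 ≤ M → 2 ≤ κ →
      ∀ A : Fin n → Fin d → ℝ,
        (∀ (i : Fin n) (t : Fin d), ∃ z : ℤ, A i t = (z : ℝ) ∧ |A i t| ≤ M) →
        (∀ i : Fin n, prefixCondLe n d A i κ) →
        ∑ i, onlineL1Sens n d A i ≤ c * d * Real.log (n * M) * Real.log κ := by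
  refine ⟨24, by norm_num, fun n d hn _ M κ hM hκ A hA hcond ↦ ?_⟩
  have hκ0 : 0 < κ := by linarith
  have hsum := sum_onlineL1Sens_div_three_le hκ0
    (fun i t ↦ (hA i t).imp fun _ hz ↦ hz.1) hcond
  have hl : 0 < (κ ^ 2)⁻¹ := by positivity
  have hl1 : (κ ^ 2)⁻¹ ≤ 1 := inv_le_one_of_one_le₀ (by nlinarith)
  have hlogdet := (posDef_regGram (A := A) (w := onlineL1Sens n d A)
    (fun _ ↦ onlineL1Sens_nonneg) hl Finset.univ).log_det_le
    (b := (κ ^ 2)⁻¹ + (n * M) ^ 2) (by positivity)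
    (by simpa using trace_regGram_onlineL1Sens_le (by omega) fun i t ↦ (hA i t).choose_spec.2)
  have hnM : 4 ≤ n * M := by
    have : (2 : ℝ) ≤ n := by exact_mod_cast hn
    nlinarith
  have hb : Real.log ((κ ^ 2)⁻¹ + (n * M) ^ 2) ≤ 3 * Real.log (n * M) := by
    have h := Real.log_le_log (by positivity)
      (show (κ ^ 2)⁻¹ + (n * M) ^ 2 ≤ (n * M) ^ 3 by nlinarith [sq_nonneg (n * M)])
    rw [Real.log_pow] at h
    exact_mod_cast h
  have hlog2 := Real.log_two_gt_d9
  have hL : 1 ≤ Real.log (n * M) := by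
    have h4 : Real.log 4 = 2 * Real.log 2 := by
      rw [show (4 : ℝ) = 2 ^ 2 by norm_num, Real.log_pow]
      norm_num
    have := Real.log_le_log (by norm_num) hnM
    linarith
  have hk : 1 / 2 ≤ Real.log κ := by
    have := Real.log_le_log (by norm_num) hκ
    linarith
  rw [Fintype.card_fin] at hlogdet
  rw [← Finset.sum_div, Real.log_inv, Real.log_pow] at hsum
  push_cast at hsum
  have hd : (0 : ℝ) ≤ d := Nat.cast_nonneg d
  have h1 : ∑ i, onlineL1Sens n d A i ≤ d * (9 * Real.log (n * M) + 6 * Real.log κ) := by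
    have := mul_le_mul_of_nonneg_left hb hd
    linarith
  have h2 : 9 * Real.log (n * M) + 6 * Real.log κ ≤ 24 * (Real.log (n * M) * Real.log κ) := by
    nlinarith
  calc _ ≤ _ := h1
    _ ≤ d * (24 * (Real.log (n * M) * Real.log κ)) := mul_le_mul_of_nonneg_left h2 hd
    _ = _ := by ring
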